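/- arXiv:2012.10140 — 2 statements merged into one kernel-verified Lean document; each statement's English description precedes it below -/
import Mathlib

section
/- Consider a finite-horizon discounted MDP skeleton (S, A, T, R, R_max, γ) with horizon D and restricted value functions V̂_d defined from nonempty subsets A'(s,d) ⊆ A. Additionally fix, for each 0 ≤ d < D and (s,a) ∈ S × A, finitely many sample states s_{d,s,a,1}, …, s_{d,s,a,C} ∈ S and weights w_{d,s,a,1}, …, w_{d,s,a,C} ≥ 0 with Σᵢ w_{d,s,a,i} > 0, and for f : S → ℝ write M_d(s,a)(f) = ( Σᵢ w_{d,s,a,i} f(s_{d,s,a,i}) ) / ( Σᵢ w_{d,s,a,i} ). Define the sample-based estimates by W_D = 0 and W_d(s) = ⨆_{a∈A'(s,d)} ( R(s,a) + γ·M_d(s,a)(W_{d+1}) ) for d < D. Suppose there is ε ≥ 0 such that |M_d(s,a)(V̂_{d+1}) − ∫_S V̂_{d+1} dT(s,a)| ≤ ε for all 0 ≤ d < D and all (s,a). Then for every 0 ≤ d ≤ D and every s ∈ S, |V̂_d(s) − W_d(s)| ≤ γ·ε·(1 − γ^{D−d})/(1 − γ) ≤ γ·ε/(1 − γ). (This is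 the deterministic skeleton of the 'sparse sampling bound' step in the VOSS Intermediate Inequality: the per-node concentration error ε for the fixed functions V̂_{d+1} propagates through the recursion α(d) = γ(ε + α(d+1)), α(D) = 0.) -/
open MeasureTheory

/-- Suprema of two real families at uniform distance at most `c` differ by at most `c`. -/
theorem abs_ciSup_sub_ciSup_le {ι : Type*} [Nonempty ι] {f g : ι → ℝ} {c : ℝ}
    (hf : BddAbove (Set.range f)) (h : ∀ i, |f i - g i| ≤ c) :
    |(⨆ i, f i) - ⨆ i, g i| ≤ c := by
  have hg : BddAbove (Set.range g) := by
    obtain ⟨B, hB⟩ := hf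
    refine ⟨B + c, ?_⟩
    rintro _ ⟨i, rfl⟩
    have h1 := hB ⟨i, rfl⟩
    have h2 := abs_le.mp (h i)
    linarith
  refine abs_sub_le_iff.mpr ⟨?_, ?_⟩
  · rw [sub_le_iff_le_add]
    refine ciSup_le fun i => ?_
    have h1 := le_ciSup hg i
    have h2 := abs_le.mp (h i)
    linarith
  · rw [sub_le_iff_le_add]
    refine ciSup_le fun i => ?_
    have h1 := le_ciSup hf i
    have h2 := abs_le.mp (h i)
    linarith

/-- A supremum of a nonempty real family bounded by `c` in absolute value is itself bounded
by `c` in absolute value. -/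
theorem abs_ciSup_le {ι : Type*} [Nonempty ι] {f : ι → ℝ} {c : ℝ} (h : ∀ i, |f i| ≤ c) :
    |⨆ i, f i| ≤ c := by
  have hf : BddAbove (Set.range f) := ⟨c, by rintro _ ⟨i, rfl⟩; exact (abs_le.mp (h i)).2⟩
  simpa using abs_ciSup_sub_ciSup_le (g := fun _ => (0 : ℝ)) hf (by simpa using h)

/-- Normalized weighted averages with nonnegative weights are 1-Lipschitz for the sup distance. -/
theorem abs_weightedAverage_sub_le {ι : Type*} [Fintype ι] {w f g : ι → ℝ} {c : ℝ}
    (hw : ∀ i, 0 ≤ w i) (hsum : 0 < ∑ i, w i) (h : ∀ i, |f i - g i| ≤ c) :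
    |(∑ i, w i * f i) / (∑ i, w i) - (∑ i, w i * g i) / ∑ i, w i| ≤ c := by
  rw [← sub_div, ← Finset.sum_sub_distrib, abs_div, abs_of_pos hsum, div_le_iff₀ hsum,
    Finset.mul_sum]
  refine (Finset.abs_sum_le_sum_abs _ _).trans (Finset.sum_le_sum fun i _ => ?_)
  rw [← mul_sub, abs_mul, abs_of_nonneg (hw i), mul_comm]
  exact mul_le_mul_of_nonneg_right (h i) (hw i)

/-- One-step lookahead values are bounded if rewards and continuation values are. -/
theorem abs_add_mul_integral_le {S : Type*} [MeasurableSpace S] (μ : Measure S)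
    [IsProbabilityMeasure μ] {f : S → ℝ} {r b γ B : ℝ} (hr : |r| ≤ b) (hγ : 0 ≤ γ)
    (hf : ∀ x, |f x| ≤ B) : |r + γ * ∫ x, f x ∂μ| ≤ b + γ * B := by
  have hI : |∫ x, f x ∂μ| ≤ B := by
    simpa using norm_integral_le_of_norm_le_const (μ := μ) (f := f) (C := B)
      (Filter.Eventually.of_forall hf)
  refine (abs_add_le _ _).trans (add_le_add hr ?_)
  rw [abs_mul, abs_of_nonneg hγ]
  exact mul_le_mul_of_nonneg_left hI hγ

/-- "Sparse sampling bound" step (deterministic skeleton): if the normalized weighted averages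
`M_d(s,a)` approximate the integrals `∫ V̂_{d+1} dT(s,a)` within `ε` at every node, then the
sample-based estimates `W_d` satisfy
`|V̂_d(s) − W_d(s)| ≤ γ·ε·(1 − γ^(D−d))/(1 − γ) ≤ γ·ε/(1 − γ)`. -/
theorem sparse_sampling_error_propagation
    {S : Type*} [MeasurableSpace S]
    {A : Type*} [Countable A] [Nonempty A]
    (T : S → A → Measure S) (hT : ∀ s a, IsProbabilityMeasure (T s a))
    (hTmeas : ∀ a : A, Measurable fun s => T s a)
    (R : S → A → ℝ) (hRmeas : ∀ a : A, Measurable fun s => R s a)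
    (Rmax : ℝ) (hRmax : 0 ≤ Rmax) (hR : ∀ s a, |R s a| ≤ Rmax)
    (γ : ℝ) (hγ0 : 0 ≤ γ) (hγ1 : γ < 1)
    (D : ℕ)
    (A' : S → ℕ → Set A) (hA' : ∀ s d, (A' s d).Nonempty)
    (Vhat : ℕ → S → ℝ)
    (hVhatD : ∀ s, Vhat D s = 0)
    (hVhat : ∀ d, d < D → ∀ s,
      Vhat d s = ⨆ a : A' s d, (R s ↑a + γ * ∫ x, Vhat (d + 1) x ∂(T s ↑a)))
    -- sample states and nonnegative weights of positive sum at every node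
    (C : ℕ) (σ : ℕ → S → A → Fin C → S) (w : ℕ → S → A → Fin C → ℝ)
    (hw : ∀ d s a i, 0 ≤ w d s a i)
    (hwsum : ∀ d s a, 0 < ∑ i, w d s a i)
    -- the normalized finitely-supported weighted average
    (M : ℕ → S → A → (S → ℝ) → ℝ)
    (hM : ∀ d s a f, M d s a f = (∑ i, w d s a i * f (σ d s a i)) / (∑ i, w d s a i))
    -- sample-based estimates
    (W : ℕ → S → ℝ)
    (hWD : ∀ s, W D s = 0)
    (hW : ∀ d, d < D → ∀ s,
      W d s = ⨆ a : A' s d, (R s ↑a + γ * M d s ↑a (W (d + 1))))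
    -- per-node concentration error
    (ε : ℝ) (hε : 0 ≤ ε)
    (hconc : ∀ d, d < D → ∀ s a,
      |M d s a (Vhat (d + 1)) - ∫ x, Vhat (d + 1) x ∂(T s a)| ≤ ε) :
    ∀ d ≤ D, ∀ s,
      |Vhat d s - W d s| ≤ γ * ε * (1 - γ ^ (D - d)) / (1 - γ) ∧
      γ * ε * (1 - γ ^ (D - d)) / (1 - γ) ≤ γ * ε / (1 - γ) := by
  have hne : ∀ s d, Nonempty (A' s d) := fun s d => (hA' s d).to_subtype
  have hpos : 0 < 1 - γ := sub_pos.mpr hγ1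
  have hbdd : ∀ n d, d + n = D → ∃ B, ∀ s, |Vhat d s| ≤ B := by
    intro n
    induction n with
    | zero =>
      rintro d rfl
      exact ⟨0, fun s => by rw [← Nat.add_zero d, hVhatD s, abs_zero]⟩
    | succ n ih =>
      intro d hd
      obtain ⟨B, hB⟩ := ih (d + 1) (by omega)
      refine ⟨Rmax + γ * B, fun s => ?_⟩
      rw [hVhat d (by omega) s]
      have := hne s d
      exact abs_ciSup_le fun a =>
        have := hT s a
        abs_add_mul_integral_le (T s a) (hR s a) hγ0 hB
  have herr : ∀ n d, d + n = D → ∀ s, |Vhat d s - W d s| ≤ γ * ε * (1 - γ ^ n) / (1 - γ) := by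
    intro n
    induction n with
    | zero =>
      intro d hd s
      obtain rfl : d = D := hd
      simp [hVhatD, hWD]
    | succ n ih =>
      intro d hd s
      have hdD : d < D := by omega
      obtain ⟨B, hB⟩ := hbdd n (d + 1) (by omega)
      have := hne s d
      rw [hVhat d hdD s, hW d hdD s]
      refine abs_ciSup_sub_ciSup_le ⟨Rmax + γ * B, ?_⟩ fun a => ?_
      · rintro _ ⟨a, rfl⟩
        have := hT s a
        exact (abs_le.mp (abs_add_mul_integral_le (T s a) (hR s a) hγ0 hB)).2
      · have havg : |M d s a (Vhat (d + 1)) - M d s a (W (d + 1))| ≤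
            γ * ε * (1 - γ ^ n) / (1 - γ) := by
          rw [hM, hM]
          exact abs_weightedAverage_sub_le (hw d s a) (hwsum d s a)
            fun i => ih (d + 1) (by omega) _
        have htri := (abs_sub_le _ _ _).trans
          (add_le_add ((abs_sub_comm _ _).trans_le (hconc d hdD s a)) havg)
        have hrec : γ * ε * (1 - γ ^ (n + 1)) / (1 - γ) =
            γ * (ε + γ * ε * (1 - γ ^ n) / (1 - γ)) := by
          field_simp
          ring
        rw [hrec, add_sub_add_left_eq_sub, ← mul_sub, abs_mul, abs_of_nonneg hγ0]
        exact mul_le_mul_of_nonneg_left htri hγ0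
  refine fun d hd s => ⟨herr (D - d) d (by omega) s, ?_⟩
  refine div_le_div_of_nonneg_right ?_ hpos.le
  exact mul_le_of_le_one_right (mul_nonneg hγ0 hε) (sub_le_self _ (pow_nonneg hγ0 _))
end

section
/- Consider a finite-horizon discounted MDP skeleton (S, A, T, R, R_max, γ) with horizon D, optimal value functions V*_d, restricted value functions V̂_d defined from nonempty subsets A'(s,d) ⊆ A with Q̂_d(s,a) = R(s,a) + γ ∫_S V̂_{d+1} dT(s,a), estimated reward functions ρ_d : S × A → ℝ, and weighted sample-based estimates W_d defined by W_D = 0 and W_d(s) = ⨆_{a∈A'(s,d)} ( ρ_d(s,a) + γ·M_d(s,a)(W_{d+1}) ), where each M_d(s,a) is a normalized finitely-supported weighted average M_d(s,a)(f) = ( Σᵢ w_{d,s,a,i} f(s_{d,s,a,i}) ) / ( Σᵢ w_{d,s,a,i} ) with weights w_{d,s,a,i} ≥ 0 of positive sum. Suppose there are ρ ≥ 0 and ε ≥ 0 such that for all s ∈ S, all a ∈ A, and all 0 ≤ d < D: (i) ⨆_{a∈A} Q̂_d(s,a) − ⨆_{a∈A'(s,d)} Q̂_d(s,a) ≤ ρ;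 (ii) |ρ_d(s,a) − R(s,a)| ≤ ε; and (iii) |M_d(s,a)(V̂_{d+1}) − ∫_S V̂_{d+1} dT(s,a)| ≤ ε. Then for every 0 ≤ d ≤ D and every s ∈ S, |V*_d(s) − W_d(s)| ≤ (ρ + (1+γ)ε)·(1 − γ^{D−d})/(1 − γ) ≤ (ρ + (1+γ)ε)/(1 − γ). (This is the deterministic skeleton of the VOWSS Inequality: the total error is bounded by the sum η_{C_a} + α_{C_s} of a regret-type bound and a concentration-type bound.) -/
open MeasureTheory

/-- Suprema of two uniformly close real families are close. -/
lemma abs_iSup_sub_iSup_le {ι : Type*} [Nonempty ι] {f g : ι → ℝ} {c : ℝ}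
    (hg : BddAbove (Set.range g)) (h : ∀ i, |f i - g i| ≤ c) :
    |(⨆ i, f i) - ⨆ i, g i| ≤ c := by
  have hfg : ∀ i, f i ≤ (⨆ i, g i) + c := fun i => by
    linarith [(abs_le.1 (h i)).2, le_ciSup hg i]
  have hf : BddAbove (Set.range f) := ⟨_, Set.forall_mem_range.2 hfg⟩
  have h1 : ⨆ i, f i ≤ (⨆ i, g i) + c := ciSup_le hfg
  have h2 : ⨆ i, g i ≤ (⨆ i, f i) + c := ciSup_le fun i => by
    linarith [(abs_le.1 (h i)).1, le_ciSup hf i]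
  exact abs_le.2 ⟨by linarith, by linarith⟩

lemma bddAbove_range_of_abs_le {ι : Type*} {f : ι → ℝ} {B : ℝ} (h : ∀ i, |f i| ≤ B) :
    BddAbove (Set.range f) :=
  ⟨B, Set.forall_mem_range.2 fun i => (abs_le.1 (h i)).2⟩

lemma abs_iSup_le_of_abs_le {ι : Type*} [Nonempty ι] {f : ι → ℝ} {B : ℝ} (h : ∀ i, |f i| ≤ B) :
    |⨆ i, f i| ≤ B := by
  simpa using abs_iSup_sub_iSup_le (f := f) (g := fun _ => 0) (c := B)
    ⟨0, Set.forall_mem_range.2 fun _ => le_rfl⟩ (by simpa using h)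

lemma abs_integral_le_of_abs_le {S : Type*} [MeasurableSpace S] (μ : Measure S)
    [IsProbabilityMeasure μ] {f : S → ℝ} {B : ℝ} (h : ∀ x, |f x| ≤ B) : |∫ x, f x ∂μ| ≤ B := by
  simpa using norm_integral_le_of_norm_le_const (μ := μ) (f := f) (.of_forall h)

/-- The bound `Rmax / (1 - γ)` is preserved by a discounted Bellman backup. -/
lemma abs_backup_le {S : Type*} [MeasurableSpace S] (μ : Measure S) [IsProbabilityMeasure μ]
    {V : S → ℝ} {r Rmax γ : ℝ} (hγ0 : 0 ≤ γ) (hγ1 : γ < 1) (hr : |r| ≤ Rmax)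
    (hV : ∀ x, |V x| ≤ Rmax / (1 - γ)) : |r + γ * ∫ x, V x ∂μ| ≤ Rmax / (1 - γ) := by
  have hfix : Rmax + γ * (Rmax / (1 - γ)) = Rmax / (1 - γ) := by
    have : 1 - γ ≠ 0 := by linarith
    field_simp
    ring
  calc |r + γ * ∫ x, V x ∂μ| ≤ |r| + γ * |∫ x, V x ∂μ| := by
        simpa [abs_mul, abs_of_nonneg hγ0] using abs_add_le r (γ * ∫ x, V x ∂μ)
    _ ≤ Rmax + γ * (Rmax / (1 - γ)) := by
        gcongr
        exact abs_integral_le_of_abs_le μ hV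
    _ = _ := hfix

/-- Values defined by backward recursion from rewards bounded by `Rmax` are bounded by
`Rmax / (1 - γ)`. -/
lemma abs_value_le {S A : Type*} [MeasurableSpace S] {T : S → A → Measure S}
    [∀ s a, IsProbabilityMeasure (T s a)] {R : S → A → ℝ} {Rmax γ : ℝ} (hRmax : 0 ≤ Rmax)
    (hR : ∀ s a, |R s a| ≤ Rmax) (hγ0 : 0 ≤ γ) (hγ1 : γ < 1) {D : ℕ}
    {ι : S → ℕ → Type*} [∀ s d, Nonempty (ι s d)] (act : ∀ s d, ι s d → A) {V : ℕ → S → ℝ}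
    (hVD : ∀ s, V D s = 0)
    (hV : ∀ d, d < D → ∀ s,
      V d s = ⨆ i, (R s (act s d i) + γ * ∫ x, V (d + 1) x ∂(T s (act s d i))))
    {d : ℕ} (hd : d ≤ D) (s : S) : |V d s| ≤ Rmax / (1 - γ) := by
  induction hd using Nat.decreasingInduction generalizing s with
  | self => simpa [hVD] using div_nonneg hRmax (by linarith)
  | of_succ k hk ih =>
    rw [hV k hk]
    exact abs_iSup_le_of_abs_le fun i => abs_backup_le _ hγ0 hγ1 (hR _ _) ih

/-- Unrestricted optimal values are measurable. -/
lemma measurable_value {S A : Type*} [MeasurableSpace S] [Countable A] {T : S → A → Measure S}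
    [∀ s a, IsProbabilityMeasure (T s a)] (hT : ∀ a, Measurable fun s => T s a)
    {R : S → A → ℝ} (hR : ∀ a, Measurable fun s => R s a) {γ : ℝ} {D : ℕ} {V : ℕ → S → ℝ}
    (hVD : ∀ s, V D s = 0)
    (hV : ∀ d, d < D → ∀ s, V d s = ⨆ a, (R s a + γ * ∫ x, V (d + 1) x ∂(T s a)))
    {d : ℕ} (hd : d ≤ D) : Measurable (V d) := by
  induction hd using Nat.decreasingInduction with
  | self => rw [funext hVD]; exact measurable_const
  | of_succ k hk ih =>
    rw [funext (hV k hk)]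
    refine Measurable.iSup fun a => (hR a).add (measurable_const.mul ?_)
    let κ : ProbabilityTheory.Kernel S S := ⟨fun s => T s a, hT a⟩
    have : ProbabilityTheory.IsMarkovKernel κ :=
      ⟨fun s => inferInstanceAs (IsProbabilityMeasure (T s a))⟩
    exact (ih.stronglyMeasurable.integral_kernel (κ := κ)).measurable

/-- Weighted averages of uniformly close functions are close. -/
lemma abs_weighted_average_sub_le {ι : Type*} [Fintype ι] {w f g : ι → ℝ} {c : ℝ}
    (hw : ∀ i, 0 ≤ w i) (hsum : 0 < ∑ i, w i) (h : ∀ i, |f i - g i| ≤ c) :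
    |(∑ i, w i * f i) / (∑ i, w i) - (∑ i, w i * g i) / (∑ i, w i)| ≤ c := by
  rw [← sub_div, abs_div, abs_of_pos hsum, div_le_iff₀ hsum, ← Finset.sum_sub_distrib,
    Finset.mul_sum]
  refine (Finset.abs_sum_le_sum_abs _ _).trans (Finset.sum_le_sum fun i _ => ?_)
  rw [← mul_sub, abs_mul, abs_of_nonneg (hw i), mul_comm]
  exact mul_le_mul_of_nonneg_right (h i) (hw i)

/-- A discounted one-step error recursion, solved backwards from a zero terminal error. -/
lemma error_le_of_backward_recursion {S : Type*} {D : ℕ} {e : ℕ → S → ℝ} {c γ : ℝ}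
    (hγ1 : γ < 1) (hD : ∀ s, e D s ≤ 0)
    (hstep : ∀ d, d < D → ∀ b, (∀ s, e (d + 1) s ≤ b) → ∀ s, e d s ≤ c + γ * b)
    {d : ℕ} (hd : d ≤ D) (s : S) : e d s ≤ c * (1 - γ ^ (D - d)) / (1 - γ) := by
  induction hd using Nat.decreasingInduction generalizing s with
  | self => simpa using hD s
  | of_succ k hk ih =>
    refine (hstep k hk _ ih s).trans_eq ?_
    have : 1 - γ ≠ 0 := by linarith
    rw [show D - k = D - (k + 1) + 1 by omega, pow_succ]
    field_simp
    ring

/-- Deterministic skeleton of the VOWSS Inequality: combining the per-node action-selection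
regret bound `ρ`, the reward-estimation error `ε`, and the per-node concentration bound `ε`
yields `|V*_d(s) − W_d(s)| ≤ (ρ + (1+γ)ε)·(1 − γ^(D−d))/(1 − γ) ≤ (ρ + (1+γ)ε)/(1 − γ)`. -/
theorem vowss_inequality_skeleton
    {S : Type*} [MeasurableSpace S]
    {A : Type*} [Countable A] [Nonempty A]
    (T : S → A → Measure S) (hT : ∀ s a, IsProbabilityMeasure (T s a))
    (hTmeas : ∀ a : A, Measurable fun s => T s a)
    (R : S → A → ℝ) (hRmeas : ∀ a : A, Measurable fun s => R s a)
    (Rmax : ℝ) (hRmax : 0 ≤ Rmax) (hR : ∀ s a, |R s a| ≤ Rmax)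
    (γ : ℝ) (hγ0 : 0 ≤ γ) (hγ1 : γ < 1)
    (D : ℕ)
    (Vstar : ℕ → S → ℝ)
    (hVstarD : ∀ s, Vstar D s = 0)
    (hVstar : ∀ d, d < D → ∀ s,
      Vstar d s = ⨆ a : A, (R s a + γ * ∫ x, Vstar (d + 1) x ∂(T s a)))
    (A' : S → ℕ → Set A) (hA' : ∀ s d, (A' s d).Nonempty)
    (Vhat : ℕ → S → ℝ)
    (hVhatMeas : ∀ d, Measurable (Vhat d))
    (hVhatD : ∀ s, Vhat D s = 0)
    (hVhat : ∀ d, d < D → ∀ s,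
      Vhat d s = ⨆ a : A' s d, (R s ↑a + γ * ∫ x, Vhat (d + 1) x ∂(T s ↑a)))
    -- sample states and nonnegative weights of positive sum at every node
    (C : ℕ) (σ : ℕ → S → A → Fin C → S) (w : ℕ → S → A → Fin C → ℝ)
    (hw : ∀ d s a i, 0 ≤ w d s a i)
    (hwsum : ∀ d s a, 0 < ∑ i, w d s a i)
    -- the normalized finitely-supported weighted average
    (M : ℕ → S → A → (S → ℝ) → ℝ)
    (hM : ∀ d s a f, M d s a f = (∑ i, w d s a i * f (σ d s a i)) / (∑ i, w d s a i))
    -- estimated reward functions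
    (ρd : ℕ → S → A → ℝ)
    -- weighted sample-based estimates
    (W : ℕ → S → ℝ)
    (hWD : ∀ s, W D s = 0)
    (hW : ∀ d, d < D → ∀ s,
      W d s = ⨆ a : A' s d, (ρd d s ↑a + γ * M d s ↑a (W (d + 1))))
    -- (i) per-node action-selection regret
    (ρ : ℝ) (hρ : 0 ≤ ρ)
    (hregret : ∀ s, ∀ d, d < D →
      (⨆ a : A, (R s a + γ * ∫ x, Vhat (d + 1) x ∂(T s a))) -
        (⨆ a : A' s d, (R s ↑a + γ * ∫ x, Vhat (d + 1) x ∂(T s ↑a))) ≤ ρ)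
    -- (ii) reward-estimation error and (iii) per-node concentration error
    (ε : ℝ) (hε : 0 ≤ ε)
    (hρd : ∀ d, d < D → ∀ s, ∀ a : A, |ρd d s a - R s a| ≤ ε)
    (hconc : ∀ d, d < D → ∀ s, ∀ a : A,
      |M d s a (Vhat (d + 1)) - ∫ x, Vhat (d + 1) x ∂(T s a)| ≤ ε) :
    ∀ d ≤ D, ∀ s,
      |Vstar d s - W d s| ≤ (ρ + (1 + γ) * ε) * (1 - γ ^ (D - d)) / (1 - γ) ∧
      (ρ + (1 + γ) * ε) * (1 - γ ^ (D - d)) / (1 - γ) ≤ (ρ + (1 + γ) * ε) / (1 - γ) := by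
  have hVstarB : ∀ d ≤ D, ∀ s, |Vstar d s| ≤ Rmax / (1 - γ) := fun d hd s =>
    abs_value_le hRmax hR hγ0 hγ1 (ι := fun _ _ => A) (fun _ _ a => a) hVstarD hVstar hd s
  have (s : S) (d : ℕ) : Nonempty (A' s d) := (hA' s d).to_subtype
  have hVhatB : ∀ d ≤ D, ∀ s, |Vhat d s| ≤ Rmax / (1 - γ) := fun d hd s =>
    abs_value_le hRmax hR hγ0 hγ1 (ι := fun s d => A' s d) (fun _ _ a => a) hVhatD hVhat hd s
  have hQB : ∀ d < D, ∀ s a, |R s a + γ * ∫ x, Vhat (d + 1) x ∂(T s a)| ≤ Rmax / (1 - γ) :=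
    fun d hd s a => abs_backup_le _ hγ0 hγ1 (hR s a) (hVhatB (d + 1) hd)
  have hrestrict : ∀ d ≤ D, ∀ s,
      |Vstar d s - Vhat d s| ≤ ρ * (1 - γ ^ (D - d)) / (1 - γ) := fun d hd s =>
    error_le_of_backward_recursion (e := fun d s => |Vstar d s - Vhat d s|) hγ1
      (by simp [hVstarD, hVhatD]) (fun k hk b hb s => by
        have hmeas : Measurable (Vstar (k + 1)) := measurable_value hTmeas hRmeas hVstarD hVstar hk
        have hint : ∀ a, |(∫ x, Vstar (k + 1) x ∂(T s a)) - ∫ x, Vhat (k + 1) x ∂(T s a)| ≤ b := by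
          intro a
          rw [← integral_sub
            (.of_bound hmeas.aestronglyMeasurable _ (.of_forall (hVstarB (k + 1) hk)))
            (.of_bound (hVhatMeas (k + 1)).aestronglyMeasurable _
              (.of_forall (hVhatB (k + 1) hk)))]
          exact abs_integral_le_of_abs_le _ hb
        have hbdd := bddAbove_range_of_abs_le (hQB k hk s)
        have hclose : |Vstar k s - ⨆ a : A, (R s a + γ * ∫ x, Vhat (k + 1) x ∂(T s a))| ≤
            γ * b := by
          rw [hVstar k hk]
          refine abs_iSup_sub_iSup_le hbdd fun a => ?_
          rw [add_sub_add_left_eq_sub, ← mul_sub, abs_mul, abs_of_nonneg hγ0]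
          exact mul_le_mul_of_nonneg_left (hint a) hγ0
        have hle : Vhat k s ≤ ⨆ a : A, (R s a + γ * ∫ x, Vhat (k + 1) x ∂(T s a)) := by
          rw [hVhat k hk]
          exact ciSup_le fun a => le_ciSup hbdd (a : A)
        have hreg := hregret s k hk
        rw [← hVhat k hk] at hreg
        rw [abs_le] at hclose ⊢
        constructor <;> linarith) hd s
  have hsample : ∀ d ≤ D, ∀ s,
      |W d s - Vhat d s| ≤ ((1 + γ) * ε) * (1 - γ ^ (D - d)) / (1 - γ) := fun d hd s =>
    error_le_of_backward_recursion (e := fun d s => |W d s - Vhat d s|) hγ1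
      (by simp [hWD, hVhatD]) (fun k hk b hb s => by
        simp only [hW k hk, hVhat k hk]
        refine abs_iSup_sub_iSup_le (bddAbove_range_of_abs_le fun a => hQB k hk s a) fun a => ?_
        have hM' : |M k s a (W (k + 1)) - M k s a (Vhat (k + 1))| ≤ b := by
          rw [hM, hM]
          exact abs_weighted_average_sub_le (hw k s a) (hwsum k s a) fun i => hb _
        have hc : |M k s a (W (k + 1)) - ∫ x, Vhat (k + 1) x ∂(T s a)| ≤ b + ε :=
          (abs_sub_le _ _ _).trans (add_le_add hM' (hconc k hk s a))
        calc _ = |(ρd k s a - R s a)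
                + γ * (M k s a (W (k + 1)) - ∫ x, Vhat (k + 1) x ∂(T s a))| := by ring_nf
          _ ≤ |ρd k s a - R s a|
                + γ * |M k s a (W (k + 1)) - ∫ x, Vhat (k + 1) x ∂(T s a)| := by
              refine (abs_add_le _ _).trans_eq ?_
              rw [abs_mul, abs_of_nonneg hγ0]
          _ ≤ ε + γ * (b + ε) := by
              gcongr
              exact hρd k hk s a
          _ = _ := by ring) hd s
  intro d hd s
  have hγ : 0 < 1 - γ := by linarith
  constructor
  · calc |Vstar d s - W d s| ≤ |Vstar d s - Vhat d s| + |W d s - Vhat d s| := by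
          rw [abs_sub_comm (W d s)]
          exact abs_sub_le _ _ _
      _ ≤ _ := add_le_add (hrestrict d hd s) (hsample d hd s)
      _ = _ := by ring
  · have hc : 0 ≤ ρ + (1 + γ) * ε := by positivity
    gcongr
    exact mul_le_of_le_one_right hc (by linarith [pow_nonneg hγ0 (D - d)])
end
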